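/- arXiv:1703.06177 — 2 statements merged into one kernel-verified Lean document; each statement's English description precedes it below -/
import Mathlib

section
/- Partition D and W into blocks D11, D22 and W11, W12, W21, W22 where the '1' index ranges over the first n coordinates and the '2' index over the last m coordinates. Suppose λ > 0, V + λL is invertible, I_n + λD11 − λW11 is invertible, and D22 − W22 − λ W21 (I_n + λD11 − λW11)^{−1} W12 is invertible. Then the last m coordinates of the soft-criterion solution f̂ = (V + λL)^{−1} V Ỹ are given by f̂_{(n+1):(n+m)} = (D22 − W22 − λ W21 (I_n + λD11 − λW11)^{−1} W12)^{−1} W21 (I_n + λD11 − λW11)^{−1} Y_n, where Y_n = (Y_1, …, Y_n)^T. -/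
open Matrix BigOperators

/-- Block elimination through a Schur complement: the second component of the solution of
`M x = y + c B z`, `E z = C x`. -/
theorem eq_schur_inv_mulVec {K p q : Type*} [CommRing K] [Fintype p] [DecidableEq p]
    [Fintype q] [DecidableEq q] {M : Matrix p p K} {B : Matrix p q K} {C : Matrix q p K}
    {E : Matrix q q K} {c : K} {x y : p → K} {z : q → K} (hM : IsUnit M)
    (hS : IsUnit (E - c • (C * M⁻¹ * B))) (h₁ : M *ᵥ x = y + c • (B *ᵥ z))
    (h₂ : E *ᵥ z = C *ᵥ x) :
    z = ((E - c • (C * M⁻¹ * B))⁻¹ * (C * M⁻¹)) *ᵥ y := by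
  have hM' : IsUnit M.det := (Matrix.isUnit_iff_isUnit_det _).1 hM
  have hS' := (Matrix.isUnit_iff_isUnit_det _).1 hS
  have hx : x = M⁻¹ *ᵥ y + c • (M⁻¹ *ᵥ (B *ᵥ z)) := by
    rw [← Matrix.mulVec_smul, ← Matrix.mulVec_add, ← h₁, Matrix.mulVec_mulVec,
      Matrix.nonsing_inv_mul _ hM', Matrix.one_mulVec]
  have hz : (E - c • (C * M⁻¹ * B)) *ᵥ z = (C * M⁻¹) *ᵥ y := by
    rw [Matrix.sub_mulVec, h₂, hx, Matrix.mulVec_add, Matrix.mulVec_smul, Matrix.smul_mulVec]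
    simp only [Matrix.mulVec_mulVec, Matrix.mul_assoc, add_sub_cancel_right]
  rw [← Matrix.mulVec_mulVec, ← hz, Matrix.mulVec_mulVec, Matrix.nonsing_inv_mul _ hS',
    Matrix.one_mulVec]

/-- Block formula for the last `m` coordinates of the soft-criterion
solution `f̂ = (V + λL)⁻¹ V Ỹ`:
`f̂_{(n+1):(n+m)} = (D22 - W22 - λ W21 (Iₙ + λD11 - λW11)⁻¹ W12)⁻¹ W21 (Iₙ + λD11 - λW11)⁻¹ Yₙ`. -/
theorem soft_solution_block_formula (n m : ℕ)
    (W : Matrix (Fin (n + m)) (Fin (n + m)) ℝ)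
    (hW_symm : W.IsSymm) (hW_nonneg : ∀ i j, 0 ≤ W i j)
    (D : Matrix (Fin (n + m)) (Fin (n + m)) ℝ)
    (hD : D = Matrix.diagonal (fun i => ∑ j, W i j))
    (L : Matrix (Fin (n + m)) (Fin (n + m)) ℝ)
    (hL : L = D - W)
    (Y : Fin n → ℝ)
    (Ytilde : Fin (n + m) → ℝ)
    (hYtilde₁ : ∀ i : Fin n, Ytilde (Fin.castAdd m i) = Y i)
    (hYtilde₂ : ∀ a : Fin m, Ytilde (Fin.natAdd n a) = 0)
    (V : Matrix (Fin (n + m)) (Fin (n + m)) ℝ)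
    (hV : V = Matrix.diagonal (fun i : Fin (n + m) => if (i : ℕ) < n then (1 : ℝ) else 0))
    (lam : ℝ) (hlam : 0 < lam)
    (D11 W11 : Matrix (Fin n) (Fin n) ℝ)
    (hD11 : D11 = D.submatrix (Fin.castAdd m) (Fin.castAdd m))
    (hW11 : W11 = W.submatrix (Fin.castAdd m) (Fin.castAdd m))
    (W12 : Matrix (Fin n) (Fin m) ℝ)
    (hW12 : W12 = W.submatrix (Fin.castAdd m) (Fin.natAdd n))
    (W21 : Matrix (Fin m) (Fin n) ℝ)
    (hW21 : W21 = W.submatrix (Fin.natAdd n) (Fin.castAdd m))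
    (D22 W22 : Matrix (Fin m) (Fin m) ℝ)
    (hD22 : D22 = D.submatrix (Fin.natAdd n) (Fin.natAdd n))
    (hW22 : W22 = W.submatrix (Fin.natAdd n) (Fin.natAdd n))
    (hU₁ : IsUnit (V + lam • L))
    (hU₂ : IsUnit ((1 : Matrix (Fin n) (Fin n) ℝ) + lam • D11 - lam • W11))
    (hU₃ : IsUnit (D22 - W22 -
        lam • (W21 * ((1 : Matrix (Fin n) (Fin n) ℝ) + lam • D11 - lam • W11)⁻¹ * W12))) :
    ∀ a : Fin m,
      ((V + lam • L)⁻¹ *ᵥ (V *ᵥ Ytilde)) (Fin.natAdd n a)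
        = (((D22 - W22 -
              lam • (W21 * ((1 : Matrix (Fin n) (Fin n) ℝ) + lam • D11 - lam • W11)⁻¹ * W12))⁻¹
            * (W21 * ((1 : Matrix (Fin n) (Fin n) ℝ) + lam • D11 - lam • W11)⁻¹)) *ᵥ Y) a := by
  set f := (V + lam • L)⁻¹ *ᵥ (V *ᵥ Ytilde) with hf
  have hsys : (V + lam • L) *ᵥ f = V *ᵥ Ytilde := by
    rw [hf, Matrix.mulVec_mulVec,
      Matrix.mul_nonsing_inv _ ((Matrix.isUnit_iff_isUnit_det _).1 hU₁), Matrix.one_mulVec]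
  have hcoord (i : Fin (n + m)) :
      V i i * f i + lam * (D i i * f i - ∑ j, W i j * f j) = V i i * Ytilde i := by
    have h := congrFun hsys i
    rw [hL, Matrix.add_mulVec, Matrix.smul_mulVec, Matrix.sub_mulVec] at h
    simp only [hV, hD, Pi.add_apply, Pi.smul_apply, Pi.sub_apply, Matrix.mulVec_diagonal,
      smul_eq_mul] at h
    simpa only [hV, hD, Matrix.diagonal_apply_eq, Matrix.mulVec, dotProduct] using h
  have hD11' : D11 = Matrix.diagonal fun i => D (Fin.castAdd m i) (Fin.castAdd m i) := by
    ext i j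
    simp [hD11, hD, Matrix.diagonal_apply]
  have hD22' : D22 = Matrix.diagonal fun a => D (Fin.natAdd n a) (Fin.natAdd n a) := by
    ext a b
    simp [hD22, hD, Matrix.diagonal_apply]
  intro a
  refine congrFun (eq_schur_inv_mulVec (x := fun i => f (Fin.castAdd m i))
    (z := fun b => f (Fin.natAdd n b)) hU₂ hU₃ ?_ ?_) a
  · ext i
    have h := hcoord (Fin.castAdd m i)
    have hVi : V (Fin.castAdd m i) (Fin.castAdd m i) = 1 := by simp [hV]
    rw [hVi, hYtilde₁, Fin.sum_univ_add] at h
    rw [Matrix.sub_mulVec, Matrix.add_mulVec, Matrix.one_mulVec, Matrix.smul_mulVec,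
      Matrix.smul_mulVec, hD11', hW11, hW12]
    simp only [Pi.add_apply, Pi.smul_apply, Pi.sub_apply, Matrix.mulVec_diagonal, smul_eq_mul]
    simp only [Matrix.mulVec, dotProduct, Matrix.submatrix_apply]
    linarith
  · ext b
    have h := hcoord (Fin.natAdd n b)
    have hVb : V (Fin.natAdd n b) (Fin.natAdd n b) = 0 := by simp [hV]
    rw [hVb, zero_mul, zero_mul, zero_add, Fin.sum_univ_add] at h
    have h' := (mul_eq_zero.1 h).resolve_left hlam.ne'
    rw [Matrix.sub_mulVec, hD22', hW22, hW21]
    simp only [Pi.sub_apply, Matrix.mulVec_diagonal]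
    simp only [Matrix.mulVec, dotProduct, Matrix.submatrix_apply]
    linarith
end

section
/- Partition D and W into blocks so that D22 and W22 are the m×m bottom-right blocks and W21 is the m×n bottom-left block. If D22 − W22 is invertible, then the hard criterion — minimize Σ_{i=1}^{n+m} Σ_{j=1}^{n+m} w_{ij}(f_i − f_j)^2 over f ∈ ℝ^{n+m} subject to f_i = Y_i for i = 1, …, n — has a unique minimizer, and its last m coordinates are f̂_{(n+1):(n+m)} = (D22 − W22)^{−1} W21 Y_n, where Y_n = (Y_1, …, Y_n)^T. -/
open Matrix BigOperators

/-- Expansion of the graph energy of `f + h` for symmetric weights: the cross term pairs `h` with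
the graph Laplacian of `f`. -/
theorem graphEnergy_add {ι : Type*} [Fintype ι] {W : Matrix ι ι ℝ} (hW : W.IsSymm)
    (f h : ι → ℝ) :
    ∑ i, ∑ j, W i j * ((f + h) i - (f + h) j) ^ 2 =
      ∑ i, ∑ j, W i j * (f i - f j) ^ 2 + ∑ i, ∑ j, W i j * (h i - h j) ^ 2 +
        4 * ∑ i, h i * ∑ j, W i j * (f i - f j) := by
  have hswap : ∑ i, ∑ j, W i j * (f i - f j) * h j =
      -∑ i, h i * ∑ j, W i j * (f i - f j) := by
    rw [Finset.sum_comm, ← Finset.sum_neg_distrib]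
    refine Finset.sum_congr rfl fun i _ => ?_
    rw [Finset.mul_sum, ← Finset.sum_neg_distrib]
    refine Finset.sum_congr rfl fun j _ => ?_
    rw [hW.apply i j]
    ring
  have hexpand : ∑ i, ∑ j, W i j * ((f + h) i - (f + h) j) ^ 2 =
      ∑ i, ∑ j, W i j * (f i - f j) ^ 2 + ∑ i, ∑ j, W i j * (h i - h j) ^ 2 +
        2 * ∑ i, h i * ∑ j, W i j * (f i - f j) -
        2 * ∑ i, ∑ j, W i j * (f i - f j) * h j := by
    simp only [Finset.mul_sum, ← Finset.sum_add_distrib, ← Finset.sum_sub_distrib]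
    refine Finset.sum_congr rfl fun i _ => Finset.sum_congr rfl fun j _ => ?_
    simp only [Pi.add_apply]
    ring
  rw [hexpand, hswap]
  ring

theorem graphEnergy_nonneg {ι : Type*} [Fintype ι] {W : Matrix ι ι ℝ}
    (hW : ∀ i j, 0 ≤ W i j) (f : ι → ℝ) :
    0 ≤ ∑ i, ∑ j, W i j * (f i - f j) ^ 2 :=
  Finset.sum_nonneg fun i _ => Finset.sum_nonneg fun j _ => mul_nonneg (hW i j) (sq_nonneg _)

/-- A function of zero graph energy is harmonic. -/
theorem sum_mul_sub_eq_zero_of_graphEnergy_eq_zero {ι : Type*} [Fintype ι] {W : Matrix ι ι ℝ}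
    (hW : ∀ i j, 0 ≤ W i j) {f : ι → ℝ}
    (hf : ∑ i, ∑ j, W i j * (f i - f j) ^ 2 = 0) (i : ι) :
    ∑ j, W i j * (f i - f j) = 0 := by
  have hterm : ∀ i j, 0 ≤ W i j * (f i - f j) ^ 2 :=
    fun i j => mul_nonneg (hW i j) (sq_nonneg _)
  have hrow := (Finset.sum_eq_zero_iff_of_nonneg
    fun i _ => Finset.sum_nonneg fun j _ => hterm i j).1 hf i (Finset.mem_univ i)
  refine Finset.sum_eq_zero fun j _ => ?_
  have hij := (Finset.sum_eq_zero_iff_of_nonneg fun j _ => hterm i j).1 hrow j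
    (Finset.mem_univ j)
  simpa using hij

/-- The rows of the graph Laplacian indexed by the last `m` vertices, in block form. -/
theorem sum_mul_sub_natAdd {n m : ℕ} (W : Matrix (Fin (n + m)) (Fin (n + m)) ℝ)
    (f : Fin (n + m) → ℝ) (a : Fin m) :
    ∑ j, W (Fin.natAdd n a) j * (f (Fin.natAdd n a) - f j) =
      (((Matrix.diagonal fun i => ∑ j, W i j).submatrix (Fin.natAdd n) (Fin.natAdd n) -
        W.submatrix (Fin.natAdd n) (Fin.natAdd n)) *ᵥ fun b => f (Fin.natAdd n b)) a -
      (W.submatrix (Fin.natAdd n) (Fin.castAdd m) *ᵥ fun i => f (Fin.castAdd m i)) a := by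
  have hdiag : (Matrix.diagonal fun i => ∑ j, W i j).submatrix (Fin.natAdd n) (Fin.natAdd n) =
      Matrix.diagonal fun b : Fin m => ∑ j, W (Fin.natAdd n b) j :=
    Matrix.submatrix_diagonal _ _ (Fin.natAdd_injective m n)
  rw [hdiag, Matrix.sub_mulVec, Pi.sub_apply, Matrix.mulVec_diagonal]
  simp only [mul_sub, Finset.sum_sub_distrib, ← Finset.sum_mul, Matrix.mulVec, dotProduct,
    Matrix.submatrix_apply]
  rw [Fin.sum_univ_add fun j => W (Fin.natAdd n a) j * f j]
  ring

/-- If `D22 - W22` is invertible, the hard criterion (minimize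
`∑ᵢ∑ⱼ wᵢⱼ(fᵢ-fⱼ)²` subject to `fᵢ = Yᵢ` for `i = 1,…,n`) has a unique minimizer, whose
last `m` coordinates are `(D22 - W22)⁻¹ W21 Yₙ`. -/
theorem hard_criterion_solution (n m : ℕ)
    (W : Matrix (Fin (n + m)) (Fin (n + m)) ℝ)
    (hW_symm : W.IsSymm) (hW_nonneg : ∀ i j, 0 ≤ W i j)
    (D : Matrix (Fin (n + m)) (Fin (n + m)) ℝ)
    (hD : D = Matrix.diagonal (fun i => ∑ j, W i j))
    (Y : Fin n → ℝ)
    (D22 W22 : Matrix (Fin m) (Fin m) ℝ)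
    (hD22 : D22 = D.submatrix (Fin.natAdd n) (Fin.natAdd n))
    (hW22 : W22 = W.submatrix (Fin.natAdd n) (Fin.natAdd n))
    (W21 : Matrix (Fin m) (Fin n) ℝ)
    (hW21 : W21 = W.submatrix (Fin.natAdd n) (Fin.castAdd m))
    (hinv : IsUnit (D22 - W22))
    (E : (Fin (n + m) → ℝ) → ℝ)
    (hE : E = fun f => ∑ i, ∑ j, W i j * (f i - f j) ^ 2) :
    (∃! fhat : Fin (n + m) → ℝ,
        (∀ i : Fin n, fhat (Fin.castAdd m i) = Y i) ∧
        (∀ g : Fin (n + m) → ℝ, (∀ i : Fin n, g (Fin.castAdd m i) = Y i) →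
          E fhat ≤ E g)) ∧
    (∀ fhat : Fin (n + m) → ℝ,
        ((∀ i : Fin n, fhat (Fin.castAdd m i) = Y i) ∧
         (∀ g : Fin (n + m) → ℝ, (∀ i : Fin n, g (Fin.castAdd m i) = Y i) →
           E fhat ≤ E g)) →
        ∀ a : Fin m, fhat (Fin.natAdd n a) = ((D22 - W22)⁻¹ *ᵥ (W21 *ᵥ Y)) a) := by
  subst hE
  set A := D22 - W22 with hA
  have hdet : IsUnit A.det := (Matrix.isUnit_iff_isUnit_det A).1 hinv
  have hlap (f : Fin (n + m) → ℝ) (a : Fin m) :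
      ∑ j, W (Fin.natAdd n a) j * (f (Fin.natAdd n a) - f j) =
        (A *ᵥ fun b => f (Fin.natAdd n b)) a - (W21 *ᵥ fun i => f (Fin.castAdd m i)) a := by
    rw [hA, hD22, hW22, hW21, hD]
    exact sum_mul_sub_natAdd W f a
  set x := A⁻¹ *ᵥ (W21 *ᵥ Y) with hx
  have hAx : A *ᵥ x = W21 *ᵥ Y := by
    rw [hx, Matrix.mulVec_mulVec, Matrix.mul_nonsing_inv _ hdet, Matrix.one_mulVec]
  set u : Fin (n + m) → ℝ := Fin.append Y x with hu
  have hu_left (i : Fin n) : u (Fin.castAdd m i) = Y i := Fin.append_left Y x i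
  have hu_right (a : Fin m) : u (Fin.natAdd n a) = x a := Fin.append_right Y x a
  have hu_harmonic (a : Fin m) :
      ∑ j, W (Fin.natAdd n a) j * (u (Fin.natAdd n a) - u j) = 0 := by
    rw [hlap]
    simp only [hu_left, hu_right, hAx, sub_self]
  have henergy (g : Fin (n + m) → ℝ) (hg : ∀ i : Fin n, g (Fin.castAdd m i) = Y i) :
      ∑ i, ∑ j, W i j * (g i - g j) ^ 2 =
        ∑ i, ∑ j, W i j * (u i - u j) ^ 2 +
          ∑ i, ∑ j, W i j * ((g - u) i - (g - u) j) ^ 2 := by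
    have hadd := graphEnergy_add hW_symm u (g - u)
    rw [add_sub_cancel] at hadd
    rw [hadd, Fin.sum_univ_add fun i => (g - u) i * ∑ j, W i j * (u i - u j)]
    simp [hu_harmonic, hg, hu_left]
  have hunique (g : Fin (n + m) → ℝ) (hg : ∀ i : Fin n, g (Fin.castAdd m i) = Y i)
      (hle : ∑ i, ∑ j, W i j * (g i - g j) ^ 2 ≤ ∑ i, ∑ j, W i j * (u i - u j) ^ 2) :
      g = u := by
    have hzero : ∑ i, ∑ j, W i j * ((g - u) i - (g - u) j) ^ 2 = 0 :=
      le_antisymm (by linarith [henergy g hg]) (graphEnergy_nonneg hW_nonneg _)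
    have hker : A *ᵥ (fun b => (g - u) (Fin.natAdd n b)) = 0 := by
      funext a
      have hrow := hlap (g - u) a
      rw [sum_mul_sub_eq_zero_of_graphEnergy_eq_zero hW_nonneg hzero] at hrow
      have hleft : (fun i => (g - u) (Fin.castAdd m i)) = 0 := by
        funext i
        simp [hg, hu_left]
      rw [hleft, Matrix.mulVec_zero, Pi.zero_apply, sub_zero] at hrow
      exact hrow.symm
    have hright := Matrix.eq_zero_of_mulVec_eq_zero hdet.ne_zero hker
    funext i
    refine Fin.addCases (fun i => ?_) (fun a => ?_) i
    · rw [hg, hu_left]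
    · exact sub_eq_zero.1 (congrFun hright a)
  refine ⟨⟨u, ⟨hu_left, fun g hg => ?_⟩, fun g hg => hunique g hg.1 (hg.2 u hu_left)⟩, ?_⟩
  · have hnonneg := graphEnergy_nonneg hW_nonneg (g - u)
    linarith [henergy g hg]
  · intro g hg a
    rw [hunique g hg.1 (hg.2 u hu_left), hu_right]
end
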